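/- Fix ρ ∈ (0, 1] and let f : ℝ → ℝ be a nondecreasing function such that |f(w)| ≤ exp(α + βw²) for all w ∈ ℝ, for some constants α ∈ ℝ and 0 < β < 1/2. Then the function c ↦ ∫_ℝ f(x)·2φ(x)Φ(λ_c x) dx, where λ_c = ρ·c/√(1 − ρ²c²), is nondecreasing on {c ∈ [0, 1] : ρ·c < 1}. -/

import Mathlib

open MeasureTheory ProbabilityTheory Real Filter
open scoped ENNReal NNReal Topology

noncomputable section

/-- Density of the standard normal distribution. -/
def stdPDF (x : ℝ) : ℝ := Real.exp (-x ^ 2 / 2) / Real.sqrt (2 * Real.pi)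

/-- Cumulative distribution function of the standard normal distribution. -/
def stdCDF (x : ℝ) : ℝ := ∫ y in Set.Iic x, stdPDF y

/-- Density of the skew normal distribution with parameter `l`. -/
def skewPDF (l x : ℝ) : ℝ := 2 * stdPDF x * stdCDF (l * x)

/-- Cumulative distribution function of the skew normal distribution `SN(l)`. -/
def skewCDF (l x : ℝ) : ℝ := ∫ y in Set.Iic x, skewPDF l y

theorem stdPDF_nonneg (x : ℝ) : 0 ≤ stdPDF x := by
  unfold stdPDF; positivity

theorem stdPDF_neg (x : ℝ) : stdPDF (-x) = stdPDF x := by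
  simp [stdPDF]

theorem integrable_stdPDF : Integrable stdPDF := by
  have h := (integrable_exp_neg_mul_sq (b := 1 / 2) (by norm_num)).div_const (√(2 * π))
  refine h.congr (ae_of_all _ fun x => ?_)
  simp only [stdPDF]
  congr 2
  ring

theorem measurable_stdPDF : Measurable stdPDF := by
  unfold stdPDF; fun_prop

theorem stdCDF_nonneg (x : ℝ) : 0 ≤ stdCDF x :=
  integral_nonneg fun y => stdPDF_nonneg y

theorem stdCDF_mono : Monotone stdCDF := fun _ _ hxy =>
  setIntegral_mono_set integrable_stdPDF.integrableOn (ae_of_all _ stdPDF_nonneg)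
    (Set.Iic_subset_Iic.2 hxy).eventuallyLE

theorem stdCDF_le_integral (x : ℝ) : stdCDF x ≤ ∫ y, stdPDF y :=
  setIntegral_le_integral integrable_stdPDF (ae_of_all _ stdPDF_nonneg)

theorem stdCDF_neg (x : ℝ) : stdCDF (-x) = (∫ y, stdPDF y) - stdCDF x := by
  have h1 : stdCDF (-x) = ∫ y in Set.Ioi x, stdPDF y := by
    have h := integral_comp_neg_Iic (-x) stdPDF
    simp only [stdPDF_neg, neg_neg] at h
    exact h
  have h2 := intervalIntegral.integral_Iic_add_Ioi (b := x)
    integrable_stdPDF.integrableOn integrable_stdPDF.integrableOn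
  rw [h1, ← h2, stdCDF]
  ring

/-- Differences of skew normal densities are odd functions. -/
theorem skewPDF_sub_neg (l l' x : ℝ) :
    skewPDF l' (-x) - skewPDF l (-x) = -(skewPDF l' x - skewPDF l x) := by
  simp only [skewPDF, stdPDF_neg, mul_neg, stdCDF_neg]
  ring

theorem skewPDF_mono_param {l l' x : ℝ} (hl : l ≤ l') (hx : 0 ≤ x) :
    skewPDF l x ≤ skewPDF l' x :=
  mul_le_mul_of_nonneg_left (stdCDF_mono (mul_le_mul_of_nonneg_right hl hx))
    (mul_nonneg zero_le_two (stdPDF_nonneg x))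

theorem integrable_mul_skewPDF {f : ℝ → ℝ} (hf : Measurable f) {α β : ℝ} (hβ : β < 1 / 2)
    (hf_bound : ∀ w : ℝ, |f w| ≤ Real.exp (α + β * w ^ 2)) (l : ℝ) :
    Integrable fun x => f x * skewPDF l x := by
  have h := ((integrable_exp_neg_mul_sq (b := 1 / 2 - β) (by linarith)).const_mul
    (Real.exp α * 2 / √(2 * π) * ∫ y, stdPDF y))
  refine h.mono' ?_ (ae_of_all _ fun x => ?_)
  · have h1 : Measurable fun x => stdCDF (l * x) :=
      stdCDF_mono.measurable.comp (measurable_const_mul l)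
    exact (hf.mul ((measurable_stdPDF.const_mul 2).mul h1)).aestronglyMeasurable
  · have h0 : 0 ≤ skewPDF l x :=
      mul_nonneg (mul_nonneg zero_le_two (stdPDF_nonneg x)) (stdCDF_nonneg _)
    rw [Real.norm_eq_abs, abs_mul, abs_of_nonneg h0]
    calc |f x| * skewPDF l x
        ≤ Real.exp (α + β * x ^ 2) * (2 * stdPDF x * ∫ y, stdPDF y) :=
          mul_le_mul (hf_bound x) (mul_le_mul_of_nonneg_left (stdCDF_le_integral _)
            (mul_nonneg zero_le_two (stdPDF_nonneg x))) h0 (Real.exp_pos _).le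
      _ = _ := by
          have he : Real.exp (-(1 / 2 - β) * x ^ 2)
              = Real.exp (β * x ^ 2) * Real.exp (-x ^ 2 / 2) := by
            rw [← Real.exp_add]; congr 1; ring
          generalize (∫ y, stdPDF y) = K
          rw [he, Real.exp_add, stdPDF]
          ring

/-- The expectation of a monotone function under `SN(l)` is monotone in `l`. -/
theorem integral_mul_skewPDF_mono {f : ℝ → ℝ} (hf : Monotone f) {α β : ℝ} (hβ : β < 1 / 2)
    (hf_bound : ∀ w : ℝ, |f w| ≤ Real.exp (α + β * w ^ 2)) {l l' : ℝ} (hl : l ≤ l') :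
    (∫ x, f x * skewPDF l x) ≤ ∫ x, f x * skewPDF l' x := by
  have hi := integrable_mul_skewPDF hf.measurable hβ hf_bound
  set g : ℝ → ℝ := fun x => f x * (skewPDF l' x - skewPDF l x) with hg
  have hgi : Integrable g := by
    simp only [hg, mul_sub]
    exact (hi l').sub (hi l)
  have hsub : ∫ x, g x = (∫ x, f x * skewPDF l' x) - ∫ x, f x * skewPDF l x := by
    simp only [hg, mul_sub]
    exact integral_sub (hi l') (hi l)
  have hsum : ∫ x, (g x + g (-x)) = 2 * ∫ x, g x := by
    rw [integral_add hgi hgi.comp_neg, integral_neg_eq_self g volume]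
    ring
  have hpos : 0 ≤ ∫ x, (g x + g (-x)) := by
    refine integral_nonneg fun x => ?_
    simp only [hg, skewPDF_sub_neg, Pi.zero_apply]
    rcases le_total 0 x with hx | hx
    · nlinarith [mul_nonneg (sub_nonneg.2 (hf (neg_le_self hx)))
        (sub_nonneg.2 (skewPDF_mono_param hl hx))]
    · have hx' : 0 ≤ -x := by linarith
      have h := mul_nonneg (sub_nonneg.2 (hf (show x ≤ -x by linarith)))
        (sub_nonneg.2 (skewPDF_mono_param hl hx'))
      rw [skewPDF_sub_neg] at h
      nlinarith
  linarith

/-- Corollary 1(ii) of the paper: fix `ρ ∈ (0,1]` and a nondecreasing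
function `f` with a square exponential bound with `β < 1/2`. Then the expectation of `f`
under `SN(ρ·c/√(1 − ρ²c²))` is nondecreasing in `c` on `{c ∈ [0,1] : ρ·c < 1}`. -/
theorem stmt7 (ρ : ℝ) (hρ0 : 0 < ρ) (hρ1 : ρ ≤ 1)
    (f : ℝ → ℝ) (hf_mono : Monotone f)
    (α β : ℝ) (hβ0 : 0 < β) (hβ : β < 1 / 2)
    (hf_bound : ∀ w : ℝ, |f w| ≤ Real.exp (α + β * w ^ 2)) :
    ∀ c c' : ℝ, c ∈ Set.Icc (0 : ℝ) 1 → c' ∈ Set.Icc (0 : ℝ) 1 →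
      ρ * c < 1 → ρ * c' < 1 → c ≤ c' →
      (∫ x, f x * skewPDF (ρ * c / Real.sqrt (1 - ρ ^ 2 * c ^ 2)) x) ≤
        ∫ x, f x * skewPDF (ρ * c' / Real.sqrt (1 - ρ ^ 2 * c' ^ 2)) x := by
  intro c c' hc hc' _ h1' hcc'
  refine integral_mul_skewPDF_mono hf_mono hβ hf_bound ?_
  have h0 : 0 ≤ ρ * c := mul_nonneg hρ0.le hc.1
  have hle : ρ * c ≤ ρ * c' := mul_le_mul_of_nonneg_left hcc' hρ0.le
  have hpos : 0 < 1 - ρ ^ 2 * c' ^ 2 := by nlinarith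
  exact div_le_div₀ (h0.trans hle) hle (Real.sqrt_pos.2 hpos)
    (Real.sqrt_le_sqrt (by nlinarith))
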